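/- For every ε > 0 and every input x ∈ [0,1), the mean squared error of the distance perturbation mechanism M− at input x is at most its value at the endpoint: MSE(x) ≤ MSE(0), i.e., the worst-case MSE of M− is achieved at the endpoints x = 0 (and, by symmetry, near x = 1). -/

import Mathlib

open Real

/-- The constant `C_ε` of the distance perturbation mechanism. -/
noncomputable def distC (ε : ℝ) : ℝ := (Real.exp (ε / 2) - 1) / (2 * Real.exp ε - 2)

/-- The sampling interval `[u, v)` of the distance perturbation mechanism `M−`
with input `x`, given as the pair `(u, v)`. -/
noncomputable def distInterval (ε x : ℝ) : ℝ × ℝ :=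
  if distC ε ≤ x ∧ x < 1 - distC ε then (x - distC ε, x + distC ε)
  else if 0 ≤ x ∧ x < distC ε then (0, 2 * distC ε)
  else (1 - 2 * distC ε, 1)

/-- Output density of the distance perturbation mechanism `M−` with input `x`. -/
noncomputable def distDensity (ε x y : ℝ) : ℝ :=
  if (distInterval ε x).1 ≤ y ∧ y < (distInterval ε x).2 then Real.exp (ε / 2)
  else Real.exp (ε / 2) / Real.exp ε

/-- Mean squared error of `M−` at input `x`. -/
noncomputable def distMSE (ε x : ℝ) : ℝ := ∫ y in (0:ℝ)..1, (y - x) ^ 2 * distDensity ε x y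

/-- Second moment about `x` of a density on `[0, 1]` that equals `P` on `[u, v)` and `Q` elsewhere. -/
theorem integral_sq_sub_mul_ite (x P Q : ℝ) {u v : ℝ} (hu : 0 ≤ u) (huv : u ≤ v) (hv : v ≤ 1) :
    ∫ y in (0:ℝ)..1, (y - x) ^ 2 * (if u ≤ y ∧ y < v then P else Q) =
      Q * ((1 - x) ^ 3 + x ^ 3) / 3 + (P - Q) * ((v - x) ^ 3 - (u - x) ^ 3) / 3 := by
  have primitive (a b : ℝ) : ∫ y in a..b, (y - x) ^ 2 = ((b - x) ^ 3 - (a - x) ^ 3) / 3 := by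
    rw [intervalIntegral.integral_comp_sub_right (fun y => y ^ 2), integral_pow]
    norm_num
  have hcont : Continuous fun y : ℝ => (y - x) ^ 2 := by fun_prop
  have hint : IntervalIntegrable (fun y : ℝ => (y - x) ^ 2) MeasureTheory.volume 0 1 :=
    hcont.intervalIntegrable 0 1
  have hind : IntervalIntegrable ((Set.Ico u v).indicator fun y : ℝ => (y - x) ^ 2)
      MeasureTheory.volume 0 1 :=
    ⟨hint.1.indicator measurableSet_Ico, hint.2.indicator measurableSet_Ico⟩
  have hsplit : (fun y : ℝ => (y - x) ^ 2 * (if u ≤ y ∧ y < v then P else Q)) = fun y =>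
      Q * (y - x) ^ 2 + (P - Q) * (Set.Ico u v).indicator (fun y : ℝ => (y - x) ^ 2) y := by
    funext y
    by_cases h : u ≤ y ∧ y < v
    · rw [if_pos h, Set.indicator_of_mem (Set.mem_Ico.2 h)]
      ring
    · rw [if_neg h, Set.indicator_of_notMem (fun hy => h (Set.mem_Ico.1 hy))]
      ring
  have hset : ∫ y in (0:ℝ)..1, (Set.Ico u v).indicator (fun y : ℝ => (y - x) ^ 2) y =
      ∫ y in u..v, (y - x) ^ 2 := by
    rw [intervalIntegral.integral_of_le zero_le_one, intervalIntegral.integral_of_le huv,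
      ← MeasureTheory.integral_Ico_eq_integral_Ioc, ← MeasureTheory.integral_Ico_eq_integral_Ioc,
      MeasureTheory.setIntegral_indicator measurableSet_Ico,
      Set.inter_eq_right.2 (Set.Ico_subset_Ico hu hv)]
  rw [hsplit, intervalIntegral.integral_add (hint.const_mul Q) (hind.const_mul (P - Q)),
    intervalIntegral.integral_const_mul, intervalIntegral.integral_const_mul, hset,
    primitive, primitive]
  ring

theorem distC_eq {ε : ℝ} (hε : 0 < ε) : distC ε = 1 / (2 * (Real.exp (ε / 2) + 1)) := by
  have ht : 1 < Real.exp (ε / 2) := Real.one_lt_exp_iff.2 (by linarith)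
  have hsq : Real.exp ε = Real.exp (ε / 2) ^ 2 := by
    rw [← Real.exp_nat_mul]
    congr 1
    push_cast
    ring
  have h₁ : Real.exp (ε / 2) - 1 ≠ 0 := by linarith
  have h₂ : Real.exp (ε / 2) + 1 ≠ 0 := by linarith
  rw [distC, hsq,
    show 2 * Real.exp (ε / 2) ^ 2 - 2 = (Real.exp (ε / 2) - 1) * (2 * (Real.exp (ε / 2) + 1)) by
      ring]
  field_simp

theorem distC_pos {ε : ℝ} (hε : 0 < ε) : 0 < distC ε := by
  rw [distC_eq hε]
  positivity

theorem distC_lt_quarter {ε : ℝ} (hε : 0 < ε) : distC ε < 1 / 4 := by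
  have ht : 1 < Real.exp (ε / 2) := Real.one_lt_exp_iff.2 (by linarith)
  rw [distC_eq hε]
  exact one_div_lt_one_div_of_lt (by norm_num) (by linarith)

theorem distMSE_eq {ε x u v : ℝ} (h : distInterval ε x = (u, v))
    (hu : 0 ≤ u) (huv : u ≤ v) (hv : v ≤ 1) :
    distMSE ε x = Real.exp (ε / 2) / Real.exp ε * ((1 - x) ^ 3 + x ^ 3) / 3 +
      (Real.exp (ε / 2) - Real.exp (ε / 2) / Real.exp ε) *
        ((v - x) ^ 3 - (u - x) ^ 3) / 3 := by
  simp only [distMSE, distDensity, h]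
  exact integral_sq_sub_mul_ite x _ _ hu huv hv

/-- The worst-case MSE of `M−` is achieved at the endpoint `x = 0`:
for every input `x ∈ [0,1)`, `MSE(x) ≤ MSE(0)`. -/
theorem dist_MSE_worst_case_at_endpoint (ε : ℝ) (hε : 0 < ε)
    (x : ℝ) (hx : x ∈ Set.Ico (0:ℝ) 1) :
    distMSE ε x ≤ distMSE ε 0 := by
  obtain ⟨hx0, hx1⟩ := hx
  have hC := distC_pos hε
  have hC' := distC_lt_quarter hε
  have hzero : distInterval ε 0 = (0, 2 * distC ε) := by
    rw [distInterval, if_neg (fun h => by linarith [h.1]), if_pos ⟨le_rfl, hC⟩]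
  have hQ : 0 < Real.exp (ε / 2) / Real.exp ε := by positivity
  have hPQ : 0 ≤ Real.exp (ε / 2) - Real.exp (ε / 2) / Real.exp ε :=
    sub_nonneg.2 (div_le_self (Real.exp_pos _).le (Real.one_le_exp hε.le))
  suffices key : ∃ u v, distInterval ε x = (u, v) ∧ 0 ≤ u ∧ u ≤ v ∧ v ≤ 1 ∧
      (v - x) ^ 3 - (u - x) ^ 3 ≤ (2 * distC ε) ^ 3 by
    obtain ⟨u, v, h, hu, huv, hv, hle⟩ := key
    rw [distMSE_eq h hu huv hv, distMSE_eq hzero le_rfl (by linarith) (by linarith)]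
    have houter : (1 - x) ^ 3 + x ^ 3 ≤ 1 := by nlinarith
    have h₁ := mul_le_mul_of_nonneg_left houter hQ.le
    have h₂ := mul_le_mul_of_nonneg_left hle hPQ
    linarith
  have cube_add_le {a b : ℝ} (ha : 0 ≤ a) (hb : 0 ≤ b) : a ^ 3 + b ^ 3 ≤ (a + b) ^ 3 := by
    have : 0 ≤ 3 * a * b * (a + b) := by positivity
    linarith
  by_cases hmid : distC ε ≤ x ∧ x < 1 - distC ε
  · refine ⟨x - distC ε, x + distC ε, if_pos hmid, by linarith [hmid.1], by linarith,
      by linarith [hmid.2], ?_⟩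
    linarith [cube_add_le hC.le hC.le]
  by_cases hleft : 0 ≤ x ∧ x < distC ε
  · refine ⟨0, 2 * distC ε, by rw [distInterval, if_neg hmid, if_pos hleft], le_rfl,
      by linarith, by linarith, ?_⟩
    linarith [cube_add_le (a := 2 * distC ε - x) (b := x) (by linarith [hleft.2]) hx0]
  · have hxC : distC ε ≤ x := not_lt.1 fun h => hleft ⟨hx0, h⟩
    have hright : 1 - distC ε ≤ x := not_lt.1 fun h => hmid ⟨hxC, h⟩
    refine ⟨1 - 2 * distC ε, 1, by rw [distInterval, if_neg hmid, if_neg hleft], by linarith,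
      by linarith, le_rfl, ?_⟩
    linarith [cube_add_le (a := 1 - x) (b := x - (1 - 2 * distC ε)) (by linarith) (by linarith)]
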